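/- arXiv:2109.13976 — 6 statements merged into one kernel-verified Lean document; each statement's English description precedes it below -/
import Mathlib

section
/- Let Σ = diag(σ1, …, σd) be a diagonal matrix with σi > 0 for all i, and set S* = diag(min{1, σ1}, …, min{1, σd}). Then S* is an optimal solution of the problem min over S ⪰ 0 of (−(1/2)·log det S) subject to S ⪯ I and S ⪯ Σ; that is, S* satisfies the constraints, and for every symmetric positive definite matrix S with S ⪯ I and S ⪯ Σ one has det S ≤ det S* = ∏_{i=1}^{d} min{1, σi}. -/
open Matrix

/-- Loewner order on symmetric matrices: `A ⪯ B` iff `B - A` is positive semidefinite. -/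
def Loewner {d : ℕ} (A B : Matrix (Fin d) (Fin d) ℝ) : Prop := (B - A).PosSemidef

namespace Matrix.PosSemidef

variable {n : Type*} [Fintype n] [DecidableEq n] {A : Matrix n n ℝ}

lemma det_le_exp_trace_sub_card (hA : A.PosSemidef) :
    A.det ≤ Real.exp (A.trace - Fintype.card n) := by
  have hdet : A.det = ∏ i, hA.isHermitian.eigenvalues i := by
    simpa using hA.isHermitian.det_eq_prod_eigenvalues
  have htrace : A.trace = ∑ i, hA.isHermitian.eigenvalues i := by
    simpa using hA.isHermitian.trace_eq_sum_eigenvalues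
  calc A.det = ∏ i, hA.isHermitian.eigenvalues i := hdet
    _ ≤ ∏ i, Real.exp (hA.isHermitian.eigenvalues i - 1) :=
        Finset.prod_le_prod (fun i _ => hA.eigenvalues_nonneg i) fun i _ => by
          linarith [Real.add_one_le_exp (hA.isHermitian.eigenvalues i - 1)]
    _ = Real.exp (A.trace - Fintype.card n) := by
        rw [← Real.exp_sum, htrace]
        simp

/-- A form of Hadamard's inequality, for positive upper bounds on the diagonal entries. -/
lemma det_le_prod_of_diag_le (hA : A.PosSemidef) {m : n → ℝ} (hm : ∀ i, 0 < m i)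
    (h : ∀ i, A i i ≤ m i) : A.det ≤ ∏ i, m i := by
  set D : Matrix n n ℝ := diagonal fun i => (√(m i))⁻¹ with hD
  have hB : (D * A * D).PosSemidef := by
    simpa [hD] using hA.mul_mul_conjTranspose_same D
  have hsq (i : n) : (√(m i))⁻¹ * (√(m i))⁻¹ = (m i)⁻¹ := by
    rw [← mul_inv, Real.mul_self_sqrt (hm i).le]
  have htrace : (D * A * D).trace ≤ Fintype.card n := by
    calc (D * A * D).trace = ∑ i, A i i / m i := by
          refine Finset.sum_congr rfl fun i _ => ?_
          rw [diag_apply, hD, mul_diagonal, diagonal_mul, mul_right_comm, hsq, div_eq_inv_mul]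
      _ ≤ ∑ _i : n, (1 : ℝ) := Finset.sum_le_sum fun i _ => (div_le_one (hm i)).2 (h i)
      _ = Fintype.card n := by simp
  have hdet : (D * A * D).det = A.det / ∏ i, m i := by
    rw [det_mul, det_mul, mul_right_comm, hD, det_diagonal, ← Finset.prod_mul_distrib,
      Finset.prod_congr rfl fun i _ => hsq i, Finset.prod_inv_distrib, div_eq_inv_mul]
  have hle : (D * A * D).det ≤ 1 :=
    hB.det_le_exp_trace_sub_card.trans (Real.exp_le_one_iff.2 (sub_nonpos.2 htrace))
  rwa [hdet, div_le_one (Finset.prod_pos fun i _ => hm i)] at hle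

end Matrix.PosSemidef

/-- let `Σ = diagonal σ` with `σᵢ > 0`, and set
`S* = diagonal (min 1 σᵢ)`.  Then `S*` is optimal for
`min -(1/2) log det S  s.t.  S ⪰ 0, S ⪯ I, S ⪯ Σ`: it is feasible,
`det S* = ∏ᵢ min 1 σᵢ`, and every symmetric positive definite feasible `S`
satisfies `det S ≤ det S*`. -/
theorem maxdet_diagonal_solution
    (d : ℕ) (σ : Fin d → ℝ) (hσ : ∀ i, 0 < σ i) :
    (Matrix.diagonal (fun i => min 1 (σ i))).PosSemidef ∧
    Loewner (Matrix.diagonal (fun i => min 1 (σ i))) (1 : Matrix (Fin d) (Fin d) ℝ) ∧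
    Loewner (Matrix.diagonal (fun i => min 1 (σ i))) (Matrix.diagonal σ) ∧
    (Matrix.diagonal (fun i => min 1 (σ i))).det = ∏ i, min 1 (σ i) ∧
    ∀ S : Matrix (Fin d) (Fin d) ℝ, S.PosDef →
      Loewner S (1 : Matrix (Fin d) (Fin d) ℝ) → Loewner S (Matrix.diagonal σ) →
        S.det ≤ (Matrix.diagonal (fun i => min 1 (σ i))).det := by
  have hm (i : Fin d) : 0 < min 1 (σ i) := lt_min one_pos (hσ i)
  refine ⟨PosSemidef.diagonal fun i => (hm i).le, ?_, ?_, det_diagonal, fun S hS h1 h2 => ?_⟩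
  · rw [Loewner, ← diagonal_one, diagonal_sub]
    exact PosSemidef.diagonal fun i => sub_nonneg.2 (min_le_left _ _)
  · rw [Loewner, diagonal_sub]
    exact PosSemidef.diagonal fun i => sub_nonneg.2 (min_le_right _ _)
  · rw [det_diagonal]
    refine hS.posSemidef.det_le_prod_of_diag_le hm fun i => le_min ?_ ?_
    · simpa using h1.diag_nonneg (i := i)
    · simpa using h2.diag_nonneg (i := i)
end

section
/- Fix a d×d symmetric positive definite matrix Y, and for a symmetric positive definite matrix X define f(X) = inf { log det X − log det Q : Q symmetric positive definite, Q ⪯ X, Q ⪯ Y }. Then f is monotone with respect to the Loewner order: if X1 and X2 are symmetric positive definite with X1 ⪯ X2, then f(X1) ≤ f(X2). -/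
open Matrix

/-- For a fixed symmetric positive definite matrix `Y`,
`f(X) = inf { log det X - log det Q : Q positive definite, Q ⪯ X, Q ⪯ Y }`. -/
noncomputable def fInfo {d : ℕ} (Y X : Matrix (Fin d) (Fin d) ℝ) : ℝ :=
  sInf {r : ℝ | ∃ Q : Matrix (Fin d) (Fin d) ℝ, Q.PosDef ∧
    Loewner Q X ∧ Loewner Q Y ∧ r = Real.log X.det - Real.log Q.det}

section DeterminantBounds

variable {n : Type*} [Fintype n] [DecidableEq n]

/-- The inequality `det M ≤ exp (trace M - n)`. -/
lemma Matrix.PosSemidef.det_le_exp_trace_sub_card_s5 {M : Matrix n n ℝ} (hM : M.PosSemidef) :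
    M.det ≤ Real.exp (M.trace - Fintype.card n) := by
  rw [hM.1.det_eq_prod_eigenvalues, hM.1.trace_eq_sum_eigenvalues]
  have hsum : ∑ i, hM.1.eigenvalues i - Fintype.card n = ∑ i, (hM.1.eigenvalues i - 1) := by
    simp [Finset.sum_sub_distrib]
  simp only [RCLike.ofReal_real_eq_id, id_eq]
  rw [hsum, Real.exp_sum]
  refine Finset.prod_le_prod (fun i _ => hM.eigenvalues_nonneg i) fun i _ => ?_
  simpa using Real.add_one_le_exp (hM.1.eigenvalues i - 1)

/-- Hadamard's determinant inequality, with positive upper bounds for the diagonal. -/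
lemma Matrix.PosSemidef.det_le_prod_of_diag_le_s5 {M : Matrix n n ℝ} (hM : M.PosSemidef)
    {c : n → ℝ} (hc : ∀ i, 0 < c i) (h : ∀ i, M i i ≤ c i) : M.det ≤ ∏ i, c i := by
  set D : Matrix n n ℝ := diagonal fun i => (√(c i))⁻¹
  have hN : (D * M * Dᴴ).PosSemidef := hM.mul_mul_conjTranspose_same D
  have htrace : (D * M * Dᴴ).trace ≤ Fintype.card n := by
    have hdiag : ∀ i, (D * M * Dᴴ) i i ≤ 1 := fun i => by
      have hi : (D * M * Dᴴ) i i = M i i / c i := by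
        simp only [D, diagonal_conjTranspose, mul_diagonal, diagonal_mul, star_trivial]
        rw [mul_comm, ← mul_assoc, ← mul_inv, Real.mul_self_sqrt (hc i).le]
        field_simp
      rw [hi]
      exact (div_le_one (hc i)).2 (h i)
    simpa [trace] using Finset.sum_le_sum fun i (_ : i ∈ Finset.univ) => hdiag i
  have hdet : (D * M * Dᴴ).det = M.det / ∏ i, c i := by
    have hD : D.det * D.det = (∏ i, c i)⁻¹ := by
      simp only [D, det_diagonal]
      rw [← Finset.prod_mul_distrib, ← Finset.prod_inv_distrib]
      refine Finset.prod_congr rfl fun i _ => ?_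
      rw [← mul_inv, Real.mul_self_sqrt (hc i).le]
    rw [det_mul, det_mul, det_conjTranspose, star_trivial, mul_right_comm, hD, div_eq_inv_mul]
  have hle := hN.det_le_exp_trace_sub_card_s5.trans (Real.exp_le_one_iff.2 (sub_nonpos.2 htrace))
  rwa [hdet, div_le_one (Finset.prod_pos fun i _ => hc i)] at hle

/-- If `diagonal c ⪯ W` then the diagonal of `W⁻¹` is bounded by that of `(diagonal c)⁻¹`. -/
lemma Matrix.PosDef.inv_diag_le {W : Matrix n n ℝ} (hW : W.PosDef) {c : n → ℝ}
    (hc : ∀ i, 0 < c i) (h : (W - diagonal c).PosSemidef) (i : n) : W⁻¹ i i ≤ (c i)⁻¹ := by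
  set v : n → ℝ := W⁻¹ *ᵥ Pi.single i 1
  have hWv : W *ᵥ v = Pi.single i 1 := by
    rw [mulVec_mulVec, mul_nonsing_inv _ ((isUnit_iff_isUnit_det _).1 hW.isUnit), one_mulVec]
  have hvi : v i = W⁻¹ i i := by simp [v]
  have hpos : 0 < v i := hvi ▸ hW.inv.diag_pos
  have hquad := h.dotProduct_mulVec_nonneg v
  rw [sub_mulVec, hWv, dotProduct_sub, sub_nonneg, star_trivial, dotProduct_single_one] at hquad
  have hterm : v i * (c i * v i) ≤ v ⬝ᵥ diagonal c *ᵥ v := by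
    simp only [dotProduct, mulVec_diagonal]
    refine Finset.single_le_sum (f := fun j => v j * (c j * v j)) (fun j _ => ?_)
      (Finset.mem_univ i)
    nlinarith [mul_nonneg (hc j).le (mul_self_nonneg (v j))]
  have hle : v i * (c i * v i) ≤ v i * 1 := by linarith
  rw [← hvi, ← one_div, le_div_iff₀ (hc i)]
  linarith [le_of_mul_le_mul_left hle hpos]

/-- Simultaneous diagonalization by congruence of two positive definite matrices. -/
lemma Matrix.PosDef.exists_simultaneous_diagonalization {A B : Matrix n n ℝ}
    (hA : A.PosDef) (hB : B.PosDef) :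
    ∃ (P : Matrix n n ℝ) (q : n → ℝ), IsUnit P ∧ (∀ i, 0 < q i) ∧
      A = P * Pᴴ ∧ B = P * diagonal q * Pᴴ := by
  open scoped MatrixOrder in
  obtain ⟨C, hC⟩ := CStarAlgebra.nonneg_iff_eq_star_mul_self.mp hA.posSemidef.nonneg
  rw [star_eq_conjTranspose] at hC
  have hCu : IsUnit Cᴴ.det := by
    have hdet := hA.det_pos.ne'
    rw [hC, det_mul] at hdet
    exact (left_ne_zero_of_mul hdet).isUnit
  have hCinv : IsUnit (Cᴴ)⁻¹ := isUnit_nonsing_inv_iff.2 ((isUnit_iff_isUnit_det _).2 hCu)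
  have hT : ((Cᴴ)⁻¹ * B * ((Cᴴ)⁻¹)ᴴ).PosDef :=
    (IsUnit.posDef_star_right_conjugate_iff hCinv).2 hB
  set T := (Cᴴ)⁻¹ * B * ((Cᴴ)⁻¹)ᴴ with hTdef
  set U : Matrix n n ℝ := ↑hT.1.eigenvectorUnitary
  have hUU : U * Uᴴ = 1 := Unitary.coe_mul_star_self hT.1.eigenvectorUnitary
  have hTU : T = U * diagonal hT.1.eigenvalues * Uᴴ := hT.1.spectral_theorem
  have hBT : B = Cᴴ * T * C := by
    have hCC : (Cᴴ)⁻¹ᴴ * C = 1 := by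
      rw [conjTranspose_nonsing_inv, conjTranspose_conjTranspose]
      refine nonsing_inv_mul _ ?_
      rwa [det_conjTranspose, star_trivial] at hCu
    simp only [hTdef, Matrix.mul_assoc]
    rw [hCC, mul_nonsing_inv_cancel_left _ _ hCu, Matrix.mul_one]
  refine ⟨Cᴴ * U, hT.1.eigenvalues, ?_, hT.eigenvalues_pos, ?_, ?_⟩
  · exact ((isUnit_iff_isUnit_det _).2 hCu).mul (IsUnit.of_mul_eq_one _ hUU)
  · rw [conjTranspose_mul, conjTranspose_conjTranspose, Matrix.mul_assoc,
      ← Matrix.mul_assoc U, hUU, Matrix.one_mul, hC]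
  · refine (hBT.trans (congrArg (Cᴴ * · * C) hTU)).trans ?_
    simp only [conjTranspose_mul, conjTranspose_conjTranspose, Matrix.mul_assoc]

end DeterminantBounds

section Loewner

variable {d : ℕ}

/-- Two positive definite matrices below `Z` have a positive definite common lower bound `Q`
with `det A * det B ≤ det Z * det Q`. -/
lemma exists_lower_bound_det_mul_le {A B Z : Matrix (Fin d) (Fin d) ℝ}
    (hA : A.PosDef) (hB : B.PosDef) (hAZ : Loewner A Z) (hBZ : Loewner B Z) :
    ∃ Q : Matrix (Fin d) (Fin d) ℝ, Q.PosDef ∧ Loewner Q A ∧ Loewner Q B ∧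
      Q.det ≤ A.det ∧ A.det * B.det ≤ Z.det * Q.det := by
  obtain ⟨P, q, hP, hq, rfl, rfl⟩ := hA.exists_simultaneous_diagonalization hB
  have hPdet : IsUnit P.det := (isUnit_iff_isUnit_det _).1 hP
  have hPinv : IsUnit P⁻¹ := isUnit_nonsing_inv_iff.2 hP
  have hZ : Z.PosDef := by
    simpa [Loewner] using hA.add_posSemidef hAZ
  have hW : (P⁻¹ * Z * P⁻¹ᴴ).PosDef := (IsUnit.posDef_star_right_conjugate_iff hPinv).2 hZ
  have hPP : Pᴴ * P⁻¹ᴴ = 1 := by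
    rw [← conjTranspose_mul, nonsing_inv_mul _ hPdet, conjTranspose_one]
  have hbound : ∀ c : Fin d → ℝ, Loewner (P * diagonal c * Pᴴ) Z →
      (P⁻¹ * Z * P⁻¹ᴴ - diagonal c).PosSemidef := fun c hc => by
    have heq : P⁻¹ * Z * P⁻¹ᴴ - diagonal c = P⁻¹ * (Z - P * diagonal c * Pᴴ) * P⁻¹ᴴ := by
      rw [Matrix.mul_sub, Matrix.sub_mul]
      congr 1
      simp only [Matrix.mul_assoc]
      rw [hPP, nonsing_inv_mul_cancel_left _ _ hPdet, Matrix.mul_one]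
    rw [heq]
    exact hc.mul_mul_conjTranspose_same _
  have hle : ∀ c e : Fin d → ℝ, (∀ i, c i ≤ e i) →
      Loewner (P * diagonal c * Pᴴ) (P * diagonal e * Pᴴ) := fun c e hce => by
    have heq : P * diagonal e * Pᴴ - P * diagonal c * Pᴴ
        = P * diagonal (fun i => e i - c i) * Pᴴ := by
      rw [← diagonal_sub, Matrix.mul_sub, Matrix.sub_mul]
    rw [Loewner, heq]
    exact (PosSemidef.diagonal fun i => sub_nonneg.2 (hce i)).mul_mul_conjTranspose_same P
  have hone : P * Pᴴ = P * diagonal (fun _ => 1) * Pᴴ := by simp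
  have hdet : (P⁻¹ * Z * P⁻¹ᴴ).det * (P.det * P.det) = Z.det := by
    rw [det_mul, det_mul, det_conjTranspose, star_trivial, det_nonsing_inv]
    have := Ring.inverse_mul_cancel _ hPdet
    linear_combination Z.det * (Ring.inverse P.det * P.det + 1) * this
  have hmax : ∏ i, max 1 (q i) ≤ (P⁻¹ * Z * P⁻¹ᴴ).det := by
    have hpos : ∀ i, 0 < max 1 (q i) := fun i => lt_max_of_lt_left one_pos
    have h1 := hW.inv_diag_le (fun _ => one_pos) (hbound _ (hone ▸ hAZ))
    have h2 := hW.inv_diag_le hq (hbound _ hBZ)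
    have := hW.inv.posSemidef.det_le_prod_of_diag_le_s5 (fun i => inv_pos.2 (hpos i)) fun i => by
      rcases max_choice 1 (q i) with h | h <;> rw [h]
      exacts [h1 i, h2 i]
    rw [det_nonsing_inv, Ring.inverse_eq_inv', Finset.prod_inv_distrib] at this
    exact (inv_le_inv₀ hW.det_pos (Finset.prod_pos fun i _ => hpos i)).1 this
  have hmin : ∀ i, 0 < min 1 (q i) := fun i => lt_min one_pos (hq i)
  have hPP0 : 0 ≤ P.det * P.det := mul_self_nonneg _
  refine ⟨P * diagonal (fun i => min 1 (q i)) * Pᴴ,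
    (IsUnit.posDef_star_right_conjugate_iff hP).2 (PosDef.diagonal hmin), ?_,
    hle _ _ fun i => min_le_right _ _, ?_, ?_⟩
  · rw [hone]
    exact hle _ _ fun i => min_le_left _ _
  · simp only [det_mul, det_conjTranspose, star_trivial, det_diagonal]
    have : ∏ i, min 1 (q i) ≤ 1 :=
      Finset.prod_le_one (fun i _ => (hmin i).le) fun i _ => min_le_left _ _
    nlinarith
  · have hprod : ∏ i, q i = (∏ i, max 1 (q i)) * ∏ i, min 1 (q i) := by
      rw [← Finset.prod_mul_distrib]
      exact Finset.prod_congr rfl fun i _ => by rw [max_mul_min, one_mul]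
    rw [← hdet]
    simp only [det_mul, det_conjTranspose, star_trivial, det_diagonal, hprod] at hmax ⊢
    have h0 : 0 ≤ (P.det * P.det) * (P.det * P.det) * ∏ i, min 1 (q i) :=
      mul_nonneg (mul_nonneg hPP0 hPP0) (Finset.prod_nonneg fun i _ => (hmin i).le)
    linear_combination mul_le_mul_of_nonneg_left hmax h0

/-- The determinant is monotone on positive definite matrices. -/
lemma Loewner.det_le {A B : Matrix (Fin d) (Fin d) ℝ} (hA : A.PosDef) (hB : B.PosDef)
    (h : Loewner A B) : A.det ≤ B.det := by
  obtain ⟨Q, -, -, -, hQB, hmul⟩ :=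
    exists_lower_bound_det_mul_le hB hA (by simpa [Loewner] using PosSemidef.zero) h
  exact (le_of_mul_le_mul_left hmul hB.det_pos).trans hQB

lemma Loewner.trans {A B C : Matrix (Fin d) (Fin d) ℝ} (hAB : Loewner A B)
    (hBC : Loewner B C) : Loewner A C := by
  simpa [Loewner] using hBC.add hAB

end Loewner

/-- Lemma 2: `f` is monotone with respect to the Loewner order:
if `X1 ⪯ X2` (both symmetric positive definite), then `f(X1) ≤ f(X2)`. -/
theorem fInfo_monotone
    (d : ℕ) (Y : Matrix (Fin d) (Fin d) ℝ) (hY : Y.PosDef)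
    (X1 X2 : Matrix (Fin d) (Fin d) ℝ) (hX1 : X1.PosDef) (hX2 : X2.PosDef)
    (h12 : Loewner X1 X2) :
    fInfo Y X1 ≤ fInfo Y X2 := by
  refine le_csInf ?_ ?_
  · obtain ⟨Q, hQ, hQX, hQY, -⟩ := exists_lower_bound_det_mul_le (Z := X2 + Y) hX2 hY
      (by simpa [Loewner] using hY.posSemidef) (by simpa [Loewner] using hX2.posSemidef)
    exact ⟨_, Q, hQ, hQX, hQY, rfl⟩
  · rintro _ ⟨Q, hQ, hQX, hQY, rfl⟩
    obtain ⟨R, hR, hRX, hRQ, -, hmul⟩ := exists_lower_bound_det_mul_le hX1 hQ h12 hQX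
    have hbdd : BddBelow {r : ℝ | ∃ Q : Matrix (Fin d) (Fin d) ℝ, Q.PosDef ∧
        Loewner Q X1 ∧ Loewner Q Y ∧ r = Real.log X1.det - Real.log Q.det} := by
      refine ⟨0, ?_⟩
      rintro _ ⟨S, hS, hSX, -, rfl⟩
      exact sub_nonneg.2 (Real.log_le_log hS.det_pos (hSX.det_le hS hX1))
    refine (csInf_le hbdd ⟨R, hR, hRX, hRQ.trans hQY, rfl⟩).trans ?_
    have hlog := Real.log_le_log (mul_pos hX1.det_pos hQ.det_pos) hmul
    rw [Real.log_mul hX1.det_pos.ne' hQ.det_pos.ne',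
      Real.log_mul hX2.det_pos.ne' hR.det_pos.ne'] at hlog
    linarith
end

section
/- Let P1, P2 be d×d symmetric positive definite matrices and W1, W2 be d×d symmetric positive semidefinite matrices. Define F1(P) = inf { log det(P1 + W1) − log det Q : Q symmetric positive definite, Q ⪯ P1 + W1, Q ⪯ P } and F2(P) = inf { log det(P + W2) − log det Q : Q symmetric positive definite, Q ⪯ P + W2, Q ⪯ P2 }, for symmetric positive definite P. Then for every symmetric positive definite P there exists a symmetric positive definite P' with P' ⪯ P1 + W1 such that F1(P') + F2(P') ≤ F1(P) + F2(P); that is, the minimization of F1 + F2 over positive definite matrices may be restricted to matrices ⪯ P1 + W1. -/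
open Matrix

/-- `F1(P) = inf { log det (P1 + W1) - log det Q : Q positive definite,
`Q ⪯ P1 + W1`, `Q ⪯ P` }`. -/
noncomputable def F1 {d : ℕ} (P1 W1 : Matrix (Fin d) (Fin d) ℝ)
    (P : Matrix (Fin d) (Fin d) ℝ) : ℝ :=
  sInf {r : ℝ | ∃ Q : Matrix (Fin d) (Fin d) ℝ, Q.PosDef ∧
    Loewner Q (P1 + W1) ∧ Loewner Q P ∧ r = Real.log (P1 + W1).det - Real.log Q.det}

/-- `F2(P) = inf { log det (P + W2) - log det Q : Q positive definite,
`Q ⪯ P + W2`, `Q ⪯ P2` }`. -/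
noncomputable def F2 {d : ℕ} (P2 W2 : Matrix (Fin d) (Fin d) ℝ)
    (P : Matrix (Fin d) (Fin d) ℝ) : ℝ :=
  sInf {r : ℝ | ∃ Q : Matrix (Fin d) (Fin d) ℝ, Q.PosDef ∧
    Loewner Q (P + W2) ∧ Loewner Q P2 ∧ r = Real.log (P + W2).det - Real.log Q.det}

open scoped MatrixOrder

section LoewnerOrder

variable {n : Type*}

lemma Matrix.PosDef.of_le {A B : Matrix n n ℝ} (hA : A.PosDef) (h : A ≤ B) : B.PosDef := by
  simpa using hA.add_posSemidef (le_iff.1 h)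

variable [Fintype n]

lemma isClosed_posSemidef : IsClosed {A : Matrix n n ℝ | A.PosSemidef} := by
  simp only [posSemidef_iff_dotProduct_mulVec, Set.ofPred_and, Set.ofPred_forall, IsHermitian]
  refine (isClosed_eq (by fun_prop) continuous_id).inter (isClosed_iInter fun x => ?_)
  exact isClosed_le continuous_const (by fun_prop)

lemma Matrix.PosSemidef.two_mul_abs_apply_le {A : Matrix n n ℝ} (hA : A.PosSemidef) (i j : n) :
    2 * |A i j| ≤ A i i + A j j := by
  classical
  have hs : A j i = A i j := by simpa using hA.isHermitian.apply i j
  have h (c : ℝ) := hA.dotProduct_mulVec_nonneg (Pi.single i 1 + Pi.single j c)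
  simp only [star_trivial, mulVec_add, add_dotProduct, dotProduct_add, mulVec_single,
    single_dotProduct] at h
  have h1 := h 1
  have h2 := h (-1)
  simp [hs] at h1 h2
  rcases abs_cases (A i j) with ⟨h, _⟩ | ⟨h, _⟩ <;> rw [h] <;> linarith

lemma isCompact_Icc_zero_matrix (B : Matrix n n ℝ) : IsCompact (Set.Icc 0 B) := by
  have hbox : IsCompact (Set.univ.pi fun i : n => Set.univ.pi fun j : n =>
      Set.Icc (-(B i i + B j j)) (B i i + B j j)) :=
    isCompact_univ_pi fun i => isCompact_univ_pi fun j => isCompact_Icc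
  refine IsCompact.of_isClosed_subset hbox ?_ ?_
  · have h : Set.Icc 0 B = {A | A.PosSemidef} ∩ (fun A => B - A) ⁻¹' {A | A.PosSemidef} := by
      ext A
      simp [le_iff]
    rw [h]
    exact isClosed_posSemidef.inter (isClosed_posSemidef.preimage (by fun_prop))
  · rintro A ⟨h0, hB⟩ i - j -
    have hA := nonneg_iff_posSemidef.1 h0
    have hd (k : n) : A k k ≤ B k k := by simpa using (le_iff.1 hB).diag_nonneg (i := k)
    have h := hA.two_mul_abs_apply_le i j
    have := abs_nonneg (A i j)
    exact abs_le.1 (by linarith [hd i, hd j])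

variable [DecidableEq n]

lemma Matrix.PosDef.inv_le_inv {A B : Matrix n n ℝ} (hA : A.PosDef) (h : A ≤ B) :
    B⁻¹ ≤ A⁻¹ := by
  have hB := hA.of_le h
  let _ := hA.inv.isUnit.invertible
  let _ := hB.isUnit.invertible
  have h1 := (hA.inv.fromBlocks₂₂ B (1 : Matrix n n ℝ)).2 (by
    simpa [inv_inv_of_invertible, nonsing_inv_nonsing_inv _ ((isUnit_iff_isUnit_det A).1 hA.isUnit)]
      using le_iff.1 h)
  simpa [le_iff] using (hB.fromBlocks₁₁ (1 : Matrix n n ℝ) A⁻¹).1 h1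

lemma one_le_det_of_one_le {A : Matrix n n ℝ} (h : 1 ≤ A) : 1 ≤ A.det := by
  have hA : A.PosDef := PosDef.one.of_le h
  rw [hA.isHermitian.det_eq_prod_eigenvalues]
  refine Finset.one_le_prod fun i _ => ?_
  rw [hA.isHermitian.eigenvalues_eq]
  have h1 := (le_iff.1 h).dotProduct_mulVec_nonneg (hA.isHermitian.eigenvectorBasis i)
  rw [sub_mulVec, dotProduct_sub, one_mulVec, sub_nonneg] at h1
  have h2 := hA.isHermitian.eigenvectorBasis.inner_eq_one i
  rw [EuclideanSpace.inner_eq_star_dotProduct, dotProduct_comm] at h2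
  exact h2.symm.le.trans h1

lemma Matrix.PosSemidef.exists_det_add {B : Matrix n n ℝ} (hB : B.PosSemidef) :
    ∃ C : Matrix n n ℝ, ∀ A : Matrix n n ℝ, A.PosDef →
      (A + B).det = A.det * (1 + Cᴴ * A⁻¹ * C).det := by
  obtain ⟨C, hC⟩ := CStarAlgebra.nonneg_iff_eq_mul_star_self.1 (nonneg_iff_posSemidef.2 hB)
  refine ⟨C, fun A hA => ?_⟩
  rw [hC, star_eq_conjTranspose]
  exact det_add_mul C Cᴴ ((isUnit_iff_isUnit_det A).1 hA.isUnit)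

lemma Matrix.PosDef.det_le_det {A B : Matrix n n ℝ} (hA : A.PosDef) (h : A ≤ B) :
    A.det ≤ B.det := by
  obtain ⟨C, hC⟩ := (le_iff.1 h).exists_det_add
  have hAB := hC A hA
  rw [add_sub_cancel] at hAB
  rw [hAB]
  refine le_mul_of_one_le_right hA.det_pos.le (one_le_det_of_one_le ?_)
  simpa [le_iff] using hA.inv.posSemidef.conjTranspose_mul_mul_same C

lemma Matrix.PosDef.det_add_add_mul_det_le {R A B : Matrix n n ℝ} (hR : R.PosDef)
    (hA : A.PosSemidef) (hB : B.PosSemidef) :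
    (R + A + B).det * R.det ≤ (R + A).det * (R + B).det := by
  obtain ⟨C, hC⟩ := hB.exists_det_add
  have hRA := hR.add_posSemidef hA
  rw [hC _ hRA, hC _ hR]
  have h : (1 + Cᴴ * (R + A)⁻¹ * C).det ≤ (1 + Cᴴ * R⁻¹ * C).det := by
    refine PosDef.det_le_det
      (PosDef.one.add_posSemidef (hRA.inv.posSemidef.conjTranspose_mul_mul_same C)) ?_
    have h1 : R ≤ R + A := by simpa [le_iff] using hA
    have h2 := (le_iff.1 (hR.inv_le_inv h1)).conjTranspose_mul_mul_same C
    rw [le_iff]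
    convert h2 using 1
    noncomm_ring
  nlinarith [mul_le_mul_of_nonneg_left h (mul_pos hRA.det_pos hR.det_pos).le]

/-- `A + B - R` is an upper bound of `A` and `B` when `R` is a lower bound. -/
lemma Matrix.PosDef.det_add_sub_mul_det_le {R A B : Matrix n n ℝ} (hR : R.PosDef)
    (hA : R ≤ A) (hB : R ≤ B) : (A + B - R).det * R.det ≤ A.det * B.det := by
  have h := hR.det_add_add_mul_det_le (le_iff.1 hA) (le_iff.1 hB)
  rwa [add_sub_cancel, add_sub_cancel, ← add_sub_assoc] at h

/-- Every common upper bound `T` of `A` and `B` yields a common lower bound `R`. -/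
lemma Matrix.PosDef.exists_le_le_det_mul_le {A B T : Matrix n n ℝ} (hA : A.PosDef)
    (hB : B.PosDef) (hAT : A ≤ T) (hBT : B ≤ T) :
    ∃ R : Matrix n n ℝ, R.PosDef ∧ R ≤ A ∧ R ≤ B ∧ A.det * B.det ≤ T.det * R.det := by
  have hT := hA.of_le hAT
  have hA' := hA.inv_le_inv hAT
  have hB' := hB.inv_le_inv hBT
  have hle₁ : A⁻¹ ≤ A⁻¹ + B⁻¹ - T⁻¹ := by
    simpa only [add_sub_assoc] using le_add_of_nonneg_right (sub_nonneg.2 hB')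
  have hle₂ : B⁻¹ ≤ A⁻¹ + B⁻¹ - T⁻¹ := by
    simpa only [add_sub_right_comm] using le_add_of_nonneg_left (sub_nonneg.2 hA')
  have hS := hA.inv.of_le hle₁
  have hinv {M : Matrix n n ℝ} (hM : M.PosDef) : M⁻¹⁻¹ = M :=
    nonsing_inv_nonsing_inv _ ((isUnit_iff_isUnit_det M).1 hM.isUnit)
  refine ⟨(A⁻¹ + B⁻¹ - T⁻¹)⁻¹, hS.inv, ?_, ?_, ?_⟩
  · simpa [hinv hA] using hA.inv.inv_le_inv hle₁
  · simpa [hinv hB] using hB.inv.inv_le_inv hle₂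
  · have h := hT.inv.det_add_sub_mul_det_le hA' hB'
    have hSpos := hS.det_pos
    simp only [det_nonsing_inv, Ring.inverse_eq_inv'] at h ⊢
    have hT0 := hT.det_pos
    have hA0 := hA.det_pos
    have hB0 := hB.det_pos
    rw [← mul_inv, ← div_eq_mul_inv, div_le_iff₀ hT0, inv_mul_eq_div,
      le_div_iff₀ (mul_pos hA0 hB0)] at h
    rw [← div_eq_mul_inv, le_div_iff₀ hSpos]
    linarith

lemma Matrix.PosDef.exists_posDef_le_le {A B : Matrix n n ℝ} (hA : A.PosDef) (hB : B.PosDef) :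
    ∃ R : Matrix n n ℝ, R.PosDef ∧ R ≤ A ∧ R ≤ B := by
  obtain ⟨R, hR, hRA, hRB, -⟩ := hA.exists_le_le_det_mul_le hB (T := A + B)
    (by simpa [le_iff] using hB.posSemidef) (by simpa [le_iff] using hA.posSemidef)
  exact ⟨R, hR, hRA, hRB⟩

lemma Matrix.PosDef.exists_isMax_det {A B : Matrix n n ℝ} (hA : A.PosDef) (hB : B.PosDef) :
    ∃ Q : Matrix n n ℝ, Q.PosDef ∧ Q ≤ A ∧ Q ≤ B ∧
      ∀ R : Matrix n n ℝ, R.PosDef → R ≤ A → R ≤ B → R.det ≤ Q.det := by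
  obtain ⟨R, hR, hRA, hRB⟩ := hA.exists_posDef_le_le hB
  have hR0 : 0 ≤ R := nonneg_iff_posSemidef.2 hR.posSemidef
  obtain ⟨Q, ⟨⟨hQ0, hQA⟩, -, hQB⟩, hQ⟩ :=
    ((isCompact_Icc_zero_matrix A).inter_right
      (isCompact_Icc_zero_matrix B).isClosed).exists_isMaxOn
      ⟨R, ⟨hR0, hRA⟩, hR0, hRB⟩ (f := det) (continuous_id.matrix_det.continuousOn)
  have hmax (R : Matrix n n ℝ) (hR : R.PosDef) (hRA : R ≤ A) (hRB : R ≤ B) : R.det ≤ Q.det := by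
    have hR0 : 0 ≤ R := nonneg_iff_posSemidef.2 hR.posSemidef
    exact hQ ⟨⟨hR0, hRA⟩, hR0, hRB⟩
  refine ⟨Q, ?_, hQA, hQB, hmax⟩
  exact (nonneg_iff_posSemidef.1 hQ0).posDef_iff_det_ne_zero.2
    (hR.det_pos.trans_le (hmax R hR hRA hRB)).ne'

/-- The least log-determinant excess of `S` over common lower bounds of `S` and `B` is
monotone in `S`. -/
lemma Matrix.PosDef.exists_log_det_sub_le {S S' B R : Matrix n n ℝ} (hS' : S'.PosDef)
    (hB : B.PosDef) (hR : R.PosDef) (h : S' ≤ S) (hRS : R ≤ S) (hRB : R ≤ B) :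
    ∃ R' : Matrix n n ℝ, R'.PosDef ∧ R' ≤ S' ∧ R' ≤ B ∧
      Real.log S'.det - Real.log R'.det ≤ Real.log S.det - Real.log R.det := by
  have hST : S ≤ S + B - R := by
    simpa only [add_sub_assoc] using le_add_of_nonneg_right (sub_nonneg.2 hRB)
  have hBT : B ≤ S + B - R := by
    simpa only [add_sub_right_comm] using le_add_of_nonneg_left (sub_nonneg.2 hRS)
  obtain ⟨R', hR', hRS', hRB', hdet⟩ := hS'.exists_le_le_det_mul_le hB (h.trans hST) hBT
  refine ⟨R', hR', hRS', hRB', ?_⟩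
  have hS := hS'.of_le h
  have hT := hB.of_le hBT
  have h1 := Real.log_le_log (mul_pos hT.det_pos hR.det_pos) (hR.det_add_sub_mul_det_le hRS hRB)
  have h2 := Real.log_le_log (mul_pos hS'.det_pos hB.det_pos) hdet
  rw [Real.log_mul hT.det_pos.ne' hR.det_pos.ne', Real.log_mul hS.det_pos.ne' hB.det_pos.ne'] at h1
  rw [Real.log_mul hS'.det_pos.ne' hB.det_pos.ne',
    Real.log_mul hT.det_pos.ne' hR'.det_pos.ne'] at h2
  linarith

end LoewnerOrder

section Objective

variable {d : ℕ} {P1 P2 W1 W2 P Q : Matrix (Fin d) (Fin d) ℝ}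

lemma F1_eq_of_isMax_det (hQ : Q.PosDef) (hQA : Q ≤ P1 + W1) (hQP : Q ≤ P)
    (hmax : ∀ R : Matrix (Fin d) (Fin d) ℝ, R.PosDef → R ≤ P1 + W1 → R ≤ P → R.det ≤ Q.det) :
    F1 P1 W1 P = Real.log (P1 + W1).det - Real.log Q.det := by
  refine IsLeast.csInf_eq ⟨?_, ?_⟩
  · exact ⟨Q, hQ, hQA, hQP, rfl⟩
  · rintro r ⟨R, hR, hRA, hRP, rfl⟩
    exact sub_le_sub_left (Real.log_le_log hR.det_pos (hmax R hR hRA hRP)) _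

lemma F2_le_F2 (hP2 : P2.PosDef) (hW2 : W2.PosSemidef) (hQ : Q.PosDef) (h : Q ≤ P) :
    F2 P2 W2 Q ≤ F2 P2 W2 P := by
  have hQW := hQ.add_posSemidef hW2
  have hPW := (hQ.of_le h).add_posSemidef hW2
  obtain ⟨R, hR, hRP, hRP2⟩ := hPW.exists_posDef_le_le hP2
  refine le_csInf ⟨_, R, hR, hRP, hRP2, rfl⟩ ?_
  rintro r ⟨R, hR, hRP, hRP2, rfl⟩
  obtain ⟨R', hR', hRQ', hRP2', hle⟩ :=
    hQW.exists_log_det_sub_le hP2 hR (add_le_add_left h W2) hRP hRP2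
  refine le_trans (csInf_le ⟨0, ?_⟩ ?_) hle
  · rintro r ⟨R, hR, hRQ, -, rfl⟩
    exact sub_nonneg.2 (Real.log_le_log hR.det_pos (hR.det_le_det hRQ))
  · exact ⟨R', hR', hRQ', hRP2', rfl⟩

end Objective

/-- Proposition 1: the minimization of `F1 + F2` over positive definite
matrices can be restricted to matrices `⪯ P1 + W1`: for every positive definite `P`
there is a positive definite `P' ⪯ P1 + W1` with `F1(P') + F2(P') ≤ F1(P) + F2(P)`. -/
theorem F12_restrict_to_below_P1_add_W1
    (d : ℕ) (P1 P2 W1 W2 : Matrix (Fin d) (Fin d) ℝ)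
    (hP1 : P1.PosDef) (hP2 : P2.PosDef) (hW1 : W1.PosSemidef) (hW2 : W2.PosSemidef) :
    ∀ P : Matrix (Fin d) (Fin d) ℝ, P.PosDef →
      ∃ P' : Matrix (Fin d) (Fin d) ℝ, P'.PosDef ∧ Loewner P' (P1 + W1) ∧
        F1 P1 W1 P' + F2 P2 W2 P' ≤ F1 P1 W1 P + F2 P2 W2 P := by
  intro P hP
  obtain ⟨Q, hQ, hQA, hQP, hmax⟩ := (hP1.add_posSemidef hW1).exists_isMax_det hP
  refine ⟨Q, hQ, hQA, add_le_add (le_of_eq ?_) (F2_le_F2 hP2 hW2 hQ hQP)⟩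
  rw [F1_eq_of_isMax_det hQ hQA hQP hmax,
    F1_eq_of_isMax_det hQ hQA le_rfl fun R hR _ hRQ => hR.det_le_det hRQ]
end

section
/- Let P1, P2 be d×d symmetric positive definite matrices and W1, W2 be d×d symmetric positive semidefinite matrices, and let F1, F2 be as defined in the context. Then for every symmetric positive definite matrix P_int, F1(P_int) + F2(P_int) ≥ inf { log det(P1 + W1 + W2) − log det Q : Q symmetric positive definite, Q ⪯ P1 + W1 + W2, Q ⪯ P2 }; that is, splitting the covariance update through any intermediate covariance P_int costs at least as much information as the single-step update with combined noise W1 + W2. -/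
open Matrix

section DeterminantInequalities

variable {n : Type*} [Fintype n] [DecidableEq n]

lemma Matrix.PosSemidef.one_le_det_one_add {K : Matrix n n ℝ} (hK : K.PosSemidef) :
    1 ≤ (1 + K).det := by
  set U := hK.1.eigenvectorUnitary
  have hU : (U : Matrix n n ℝ) * star (U : Matrix n n ℝ) = 1 :=
    Unitary.coe_mul_star_self U
  have hspec : 1 + K = (U : Matrix n n ℝ) *
      diagonal (fun i => 1 + hK.1.eigenvalues i) * star (U : Matrix n n ℝ) := by
    have h := hK.1.spectral_theorem
    rw [Unitary.conjStarAlgAut_apply] at h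
    conv_lhs => rw [h]
    rw [← diagonal_add, Matrix.mul_add, Matrix.add_mul, diagonal_one, Matrix.mul_one, hU]
    rfl
  have hdet : (1 + K).det = ∏ i, (1 + hK.1.eigenvalues i) := by
    rw [hspec, det_mul, det_mul, det_diagonal, mul_right_comm, ← det_mul, hU, det_one, one_mul]
  rw [hdet]
  exact Finset.one_le_prod fun i _ => le_add_of_nonneg_right (hK.eigenvalues_nonneg i)

lemma Matrix.PosDef.det_add_conjTranspose_mul_self {A : Matrix n n ℝ} (hA : A.PosDef)
    (R : Matrix n n ℝ) : (A + Rᴴ * R).det = A.det * (1 + R * A⁻¹ * Rᴴ).det :=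
  det_add_mul Rᴴ R hA.det_pos.ne'.isUnit

open scoped MatrixOrder in
lemma Matrix.PosSemidef.exists_eq_conjTranspose_mul_self {E : Matrix n n ℝ}
    (hE : E.PosSemidef) : ∃ R : Matrix n n ℝ, E = Rᴴ * R :=
  CStarAlgebra.nonneg_iff_eq_star_mul_self.mp hE.nonneg

lemma Matrix.PosDef.det_le_det_add {A E : Matrix n n ℝ} (hA : A.PosDef) (hE : E.PosSemidef) :
    A.det ≤ (A + E).det := by
  obtain ⟨R, rfl⟩ := hE.exists_eq_conjTranspose_mul_self
  rw [hA.det_add_conjTranspose_mul_self]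
  exact le_mul_of_one_le_right hA.det_pos.le
    (hA.inv.posSemidef.mul_mul_conjTranspose_same R).one_le_det_one_add

lemma Matrix.PosDef.posSemidef_inv_sub_inv {A B : Matrix n n ℝ} (hA : A.PosDef) (hB : B.PosDef)
    (h : (B - A).PosSemidef) : (A⁻¹ - B⁻¹).PosSemidef := by
  have := hB.isUnit.invertible
  have := hA.inv.isUnit.invertible
  have h₁ := hB.fromBlocks₁₁ (1 : Matrix n n ℝ) A⁻¹
  have h₂ := hA.inv.fromBlocks₂₂ B (1 : Matrix n n ℝ)
  simp only [conjTranspose_one, Matrix.one_mul, Matrix.mul_one] at h₁ h₂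
  rw [nonsing_inv_nonsing_inv _ hA.det_pos.ne'.isUnit] at h₂
  exact h₁.mp (h₂.mpr h)

/-- Submodularity of the determinant along positive semidefinite increments. -/
lemma Matrix.PosDef.det_add_add_mul_det_le_s8 {U S T : Matrix n n ℝ} (hU : U.PosDef)
    (hS : S.PosSemidef) (hT : T.PosSemidef) :
    (U + S + T).det * U.det ≤ (U + S).det * (U + T).det := by
  obtain ⟨R, rfl⟩ := hT.exists_eq_conjTranspose_mul_self
  have hUS := hU.add_posSemidef hS
  rw [hU.det_add_conjTranspose_mul_self, hUS.det_add_conjTranspose_mul_self]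
  have hK := hUS.inv.posSemidef.mul_mul_conjTranspose_same R
  have hinv : (U⁻¹ - (U + S)⁻¹).PosSemidef :=
    hU.posSemidef_inv_sub_inv hUS (by simpa using hS)
  have hle := (PosDef.one.add_posSemidef hK).det_le_det_add (hinv.mul_mul_conjTranspose_same R)
  have hsum : 1 + R * (U + S)⁻¹ * Rᴴ + R * (U⁻¹ - (U + S)⁻¹) * Rᴴ = 1 + R * U⁻¹ * Rᴴ := by
    rw [Matrix.mul_sub, Matrix.sub_mul]; abel
  rw [hsum] at hle
  calc (U + S).det * (1 + R * (U + S)⁻¹ * Rᴴ).det * U.det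
      = (U + S).det * U.det * (1 + R * (U + S)⁻¹ * Rᴴ).det := by ring
    _ ≤ (U + S).det * U.det * (1 + R * U⁻¹ * Rᴴ).det :=
        mul_le_mul_of_nonneg_left hle (mul_pos hUS.det_pos hU.det_pos).le
    _ = _ := by ring

lemma Matrix.PosDef.log_det_le_log_det {A B : Matrix n n ℝ} (hA : A.PosDef)
    (h : (B - A).PosSemidef) : Real.log A.det ≤ Real.log B.det := by
  have := hA.det_le_det_add h
  rw [add_sub_cancel] at this
  exact Real.log_le_log hA.det_pos this

lemma Matrix.PosDef.log_det_add_add_le {U S T : Matrix n n ℝ} (hU : U.PosDef)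
    (hS : S.PosSemidef) (hT : T.PosSemidef) :
    Real.log (U + S + T).det + Real.log U.det ≤
      Real.log (U + S).det + Real.log (U + T).det := by
  have hUS := hU.add_posSemidef hS
  have hUST := hUS.add_posSemidef hT
  have hUT := hU.add_posSemidef hT
  rw [← Real.log_mul hUST.det_pos.ne' hU.det_pos.ne',
    ← Real.log_mul hUS.det_pos.ne' hUT.det_pos.ne']
  exact Real.log_le_log (mul_pos hUST.det_pos hU.det_pos) (hU.det_add_add_mul_det_le_s8 hS hT)

lemma Matrix.log_det_inv {A : Matrix n n ℝ} : Real.log A⁻¹.det = -Real.log A.det := by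
  rw [det_nonsing_inv, Ring.inverse_eq_inv', Real.log_inv]

end DeterminantInequalities

section Loewner

variable {d : ℕ}

lemma Loewner.inv_of_inv {A M : Matrix (Fin d) (Fin d) ℝ} (hA : A.PosDef) (hM : M.PosDef)
    (h : Loewner A⁻¹ M) : Loewner M⁻¹ A := by
  have := hA.inv.posSemidef_inv_sub_inv hM h
  rwa [nonsing_inv_nonsing_inv _ hA.det_pos.ne'.isUnit] at this

lemma Loewner.add_right {A B : Matrix (Fin d) (Fin d) ℝ} (h : Loewner A B)
    (W : Matrix (Fin d) (Fin d) ℝ) : Loewner (A + W) (B + W) := by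
  simpa [Loewner] using h

/-- Two positive definite matrices have a common positive definite lower bound. -/
lemma exists_posDef_loewner_loewner {A B : Matrix (Fin d) (Fin d) ℝ} (hA : A.PosDef)
    (hB : B.PosDef) : ∃ Q : Matrix (Fin d) (Fin d) ℝ, Q.PosDef ∧ Loewner Q A ∧ Loewner Q B := by
  have hM := hA.inv.add hB.inv
  refine ⟨(A⁻¹ + B⁻¹)⁻¹, hM.inv, Loewner.inv_of_inv hA hM ?_, Loewner.inv_of_inv hB hM ?_⟩
  · simpa [Loewner] using hB.inv.posSemidef
  · simpa [Loewner] using hA.inv.posSemidef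

/-- Given `C` and `Q` below `D`, some common lower bound of `C` and `Q` loses no more
log-determinant from `C` than `Q` loses from `D`. -/
lemma exists_loewner_log_det_le {C D Q : Matrix (Fin d) (Fin d) ℝ} (hC : C.PosDef)
    (hD : D.PosDef) (hQ : Q.PosDef) (hCD : Loewner C D) (hQD : Loewner Q D) :
    ∃ Z : Matrix (Fin d) (Fin d) ℝ, Z.PosDef ∧ Loewner Z C ∧ Loewner Z Q ∧
      Real.log C.det - Real.log Z.det ≤ Real.log D.det - Real.log Q.det := by
  have hS := hC.posSemidef_inv_sub_inv hD hCD
  have hT := hQ.posSemidef_inv_sub_inv hD hQD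
  have hM := (hD.inv.add_posSemidef hS).add_posSemidef hT
  have hdet := hD.inv.log_det_add_add_le hS hT
  have hMC : D⁻¹ + (C⁻¹ - D⁻¹) + (Q⁻¹ - D⁻¹) - C⁻¹ = Q⁻¹ - D⁻¹ := by abel
  have hMQ : D⁻¹ + (C⁻¹ - D⁻¹) + (Q⁻¹ - D⁻¹) - Q⁻¹ = C⁻¹ - D⁻¹ := by abel
  refine ⟨_, hM.inv, Loewner.inv_of_inv hC hM ?_, Loewner.inv_of_inv hQ hM ?_, ?_⟩
  · rwa [Loewner, hMC]
  · rwa [Loewner, hMQ]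
  · rw [log_det_inv]
    simp only [add_sub_cancel, log_det_inv] at hdet ⊢
    linarith

/-- The log-determinant gap above `Q` shrinks when the same noise is added to both matrices. -/
lemma log_det_add_sub_log_det_add_le {A Q W : Matrix (Fin d) (Fin d) ℝ} (hQ : Q.PosDef)
    (hW : W.PosSemidef) (hQA : Loewner Q A) :
    Real.log (A + W).det - Real.log (Q + W).det ≤ Real.log A.det - Real.log Q.det := by
  have := hQ.log_det_add_add_le hQA hW
  rw [add_sub_cancel] at this
  linarith

end Loewner

/-- Inequality (A): splitting the covariance update through any
intermediate positive definite covariance `P_int` costs at least as much information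
as the single-step update with the combined noise `W1 + W2`:
`F1(P_int) + F2(P_int) ≥ inf { log det (P1 + W1 + W2) - log det Q :
Q positive definite, Q ⪯ P1 + W1 + W2, Q ⪯ P2 }`. -/
theorem F12_two_step_ge_one_step
    (d : ℕ) (P1 P2 W1 W2 : Matrix (Fin d) (Fin d) ℝ)
    (hP1 : P1.PosDef) (hP2 : P2.PosDef) (hW1 : W1.PosSemidef) (hW2 : W2.PosSemidef) :
    ∀ Pint : Matrix (Fin d) (Fin d) ℝ, Pint.PosDef →
      sInf {r : ℝ | ∃ Q : Matrix (Fin d) (Fin d) ℝ, Q.PosDef ∧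
          Loewner Q (P1 + W1 + W2) ∧ Loewner Q P2 ∧
          r = Real.log (P1 + W1 + W2).det - Real.log Q.det}
        ≤ F1 P1 W1 Pint + F2 P2 W2 Pint := by
  intro Pint hPint
  have hA := hP1.add_posSemidef hW1
  have hD := hPint.add_posSemidef hW2
  rw [← sub_le_iff_le_add']
  obtain ⟨R₂, hR₂, hR₂D, hR₂P⟩ := exists_posDef_loewner_loewner hD hP2
  refine le_csInf ⟨_, R₂, hR₂, hR₂D, hR₂P, rfl⟩ ?_
  rintro _ ⟨Q₂, hQ₂, hQ₂D, hQ₂P, rfl⟩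
  rw [sub_le_comm]
  obtain ⟨R₁, hR₁, hR₁A, hR₁P⟩ := exists_posDef_loewner_loewner hA hPint
  refine le_csInf ⟨_, R₁, hR₁, hR₁A, hR₁P, rfl⟩ ?_
  rintro _ ⟨Q₁, hQ₁, hQ₁A, hQ₁P, rfl⟩
  obtain ⟨Z, hZ, hZC, hZQ, hZdet⟩ := exists_loewner_log_det_le (hQ₁.add_posSemidef hW2) hD hQ₂
    (hQ₁P.add_right W2) hQ₂D
  have hgap := log_det_add_sub_log_det_add_le hQ₁ hW2 hQ₁A
  rw [sub_le_iff_le_add]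
  have hZA := hZC.trans (hQ₁A.add_right W2)
  refine le_trans (b := Real.log (P1 + W1 + W2).det - Real.log Z.det) ?_ (by linarith)
  refine csInf_le ⟨0, ?_⟩ ⟨Z, hZ, hZA, hZQ.trans hQ₂P, rfl⟩
  rintro _ ⟨Q, hQ, hQA, -, rfl⟩
  exact sub_nonneg.mpr (hQ.log_det_le_log_det hQA)
end

section
/- Let M and N be d×d symmetric real matrices and κ > 0 with M ⪰ κI and N ⪰ κI. Then |log det M − log det N| ≤ (d/κ)·σ̄(M − N), where σ̄ denotes the maximum singular value. -/
open Matrix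

/-- `σ̄(M)`: the maximum singular value of `M`, i.e. its `ℓ²`-operator norm. -/
noncomputable def sigmaMax {d : ℕ} (M : Matrix (Fin d) (Fin d) ℝ) : ℝ :=
  ‖Matrix.toEuclideanCLM (𝕜 := ℝ) M‖

namespace Matrix

variable {n : Type*} [Fintype n] [DecidableEq n]

/-- A positive semidefinite matrix bounded above by `c • 1` has determinant at most `c ^ n`. -/
theorem PosSemidef.det_le_pow_of_sub {C : Matrix n n ℝ} {c : ℝ} (hC : C.PosSemidef)
    (h : (c • (1 : Matrix n n ℝ) - C).PosSemidef) : C.det ≤ c ^ Fintype.card n := by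
  have hle (i : n) : hC.1.eigenvalues i ≤ c := by
    have h0 := h.dotProduct_mulVec_nonneg (hC.1.eigenvectorBasis i)
    have h1 : star (hC.1.eigenvectorBasis i).ofLp ⬝ᵥ (hC.1.eigenvectorBasis i).ofLp = 1 := by
      rw [dotProduct_comm, ← EuclideanSpace.inner_eq_star_dotProduct,
        hC.1.eigenvectorBasis.inner_eq_one]
    rw [sub_mulVec, smul_mulVec, one_mulVec, hC.1.mulVec_eigenvectorBasis, dotProduct_sub,
      dotProduct_smul, dotProduct_smul, h1] at h0
    simpa using h0
  rw [hC.1.det_eq_prod_eigenvalues, ← Finset.card_univ, ← Finset.prod_const]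
  exact Finset.prod_le_prod (fun i _ ↦ hC.eigenvalues_nonneg i) fun i _ ↦ hle i

open scoped MatrixOrder in
/-- If `0 ⪯ A ⪯ c • B` with `B` positive definite, then `det A ≤ c ^ n * det B`. -/
theorem PosSemidef.det_le_pow_mul_det {A B : Matrix n n ℝ} {c : ℝ} (hA : A.PosSemidef)
    (hB : B.PosDef) (h : (c • B - A).PosSemidef) : A.det ≤ c ^ Fintype.card n * B.det := by
  obtain ⟨S, rfl⟩ := CStarAlgebra.nonneg_iff_eq_star_mul_self.mp hB.posSemidef.nonneg
  have hS : IsUnit S := isUnit_of_mul_isUnit_right hB.isUnit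
  lift S to (Matrix n n ℝ)ˣ using hS
  set T : Matrix n n ℝ := ((S⁻¹ : (Matrix n n ℝ)ˣ) : Matrix n n ℝ)
  have hST : (S : Matrix n n ℝ) * T = 1 := S.mul_inv
  have hTS : Tᴴ * star (S : Matrix n n ℝ) = 1 := by
    rw [← star_eq_conjTranspose, ← star_mul, hST, star_one]
  have hone : Tᴴ * (star (S : Matrix n n ℝ) * S) * T = 1 := by
    rw [← mul_assoc, hTS, one_mul, hST]
  have hle := (hA.conjTranspose_mul_mul_same T).det_le_pow_of_sub (c := c) <| by
    have := h.conjTranspose_mul_mul_same T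
    rwa [mul_sub, sub_mul, mul_smul_comm, smul_mul_assoc, hone] at this
  have hdet : (Tᴴ * A * T).det * (star (S : Matrix n n ℝ) * S).det = A.det := by
    have h1 := congrArg det hone
    simp only [det_mul, det_one] at h1 ⊢
    linear_combination A.det * h1
  rw [← hdet]
  exact mul_le_mul_of_nonneg_right hle hB.det_pos.le

end Matrix

/-- A matrix bounded below by a positive multiple of the identity is positive definite. -/
theorem Loewner.posDef {d : ℕ} {κ : ℝ} (hκ : 0 < κ) {M : Matrix (Fin d) (Fin d) ℝ}
    (hM : Loewner (κ • (1 : Matrix (Fin d) (Fin d) ℝ)) M) : M.PosDef := by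
  simpa using (Matrix.PosDef.one.smul hκ).add_posSemidef hM

/-- A Hermitian matrix is bounded above by `σ̄` times the identity. -/
theorem Matrix.IsHermitian.loewner_sigmaMax {d : ℕ} {A : Matrix (Fin d) (Fin d) ℝ}
    (hA : A.IsHermitian) : Loewner A (sigmaMax A • (1 : Matrix (Fin d) (Fin d) ℝ)) := by
  refine .of_dotProduct_mulVec_nonneg ((isHermitian_one.smul (.all _)).sub hA) fun x ↦ ?_
  have h := (real_inner_le_norm (WithLp.toLp 2 x)
    (toEuclideanCLM (𝕜 := ℝ) A (WithLp.toLp 2 x))).trans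
    (mul_le_mul_of_nonneg_left ((toEuclideanCLM (𝕜 := ℝ) A).le_opNorm _) (norm_nonneg _))
  have hx : x ⬝ᵥ x = ‖WithLp.toLp 2 x‖ * ‖WithLp.toLp 2 x‖ := by
    rw [← real_inner_self_eq_norm_mul_norm, EuclideanSpace.inner_eq_star_dotProduct]
    simp
  rw [inner_toEuclideanCLM] at h
  rw [sub_mulVec, smul_mulVec, one_mulVec, dotProduct_sub, dotProduct_smul, star_trivial, hx,
    sub_nonneg, smul_eq_mul, sigmaMax]
  linarith

/-- The one-sided form of `abs_log_det_sub_le`. -/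
theorem log_det_sub_le {d : ℕ} {κ : ℝ} (hκ : 0 < κ) {M N : Matrix (Fin d) (Fin d) ℝ}
    (hM : M.PosDef) (hN : Loewner (κ • (1 : Matrix (Fin d) (Fin d) ℝ)) N) :
    Real.log M.det - Real.log N.det ≤ ((d : ℝ) / κ) * sigmaMax (M - N) := by
  have hN' := hN.posDef hκ
  set s := sigmaMax (M - N)
  have hs : 0 ≤ s / κ := div_nonneg (norm_nonneg _) hκ.le
  have hle : ((1 + s / κ) • N - M).PosSemidef := by
    have h := (hM.1.sub hN'.1).loewner_sigmaMax.add (Matrix.PosSemidef.smul hN hs)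
    convert h using 1
    rw [smul_sub, smul_smul, div_mul_cancel₀ _ hκ.ne', add_smul, one_smul]
    abel
  have hdet := hM.posSemidef.det_le_pow_mul_det hN' hle
  rw [Fintype.card_fin] at hdet
  have hlog := Real.log_le_log hM.det_pos hdet
  rw [Real.log_mul (by positivity) hN'.det_pos.ne', Real.log_pow] at hlog
  have h1 := Real.log_le_sub_one_of_pos (show 0 < 1 + s / κ by positivity)
  calc Real.log M.det - Real.log N.det ≤ d * Real.log (1 + s / κ) := by linarith
    _ ≤ d * (s / κ) := by gcongr; linarith
    _ = (d : ℝ) / κ * s := by ring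

/-- Lemma 6: if `M ⪰ κ I` and `N ⪰ κ I` with `κ > 0`, then
`|log det M - log det N| ≤ (d/κ) σ̄(M - N)`. -/
theorem abs_log_det_sub_le
    (d : ℕ) (κ : ℝ) (hκ : 0 < κ) (M N : Matrix (Fin d) (Fin d) ℝ)
    (hM : Loewner (κ • (1 : Matrix (Fin d) (Fin d) ℝ)) M)
    (hN : Loewner (κ • (1 : Matrix (Fin d) (Fin d) ℝ)) N) :
    |Real.log M.det - Real.log N.det| ≤ ((d : ℝ) / κ) * sigmaMax (M - N) := by
  have hsymm : sigmaMax (N - M) = sigmaMax (M - N) := by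
    rw [sigmaMax, sigmaMax, ← neg_sub, map_neg, norm_neg]
  refine abs_sub_le_iff.mpr ⟨log_det_sub_le hκ (hM.posDef hκ) hN, ?_⟩
  rw [← hsymm]
  exact log_det_sub_le hκ (hN.posDef hκ) hM
end

section
/- Let X, Y, and Θ be d×d symmetric real matrices and ε > 0 with 0 ⪯ X ⪯ (1/ε)I and 0 ⪯ Y ⪯ (1/ε)I. Then σ̄(XΘX − YΘY) ≤ (3σ̄(Θ)/ε)·σ̄(X − Y), where σ̄ denotes the maximum singular value. -/
open Matrix

/-- A positive semidefinite matrix dominated by `c • 1` squares to at most `c` times itself. -/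
theorem Matrix.PosSemidef.smul_sub_mul_self {d : ℕ} {c : ℝ} (hc : 0 < c)
    {X : Matrix (Fin d) (Fin d) ℝ} (h0 : X.PosSemidef) (h1 : Loewner X (c • 1)) :
    (c • X - X * X).PosSemidef := by
  have hX := h1.mul_mul_conjTranspose_same X
  have hX' := h0.mul_mul_conjTranspose_same (c • 1 - X)
  rw [h0.isHermitian.eq] at hX
  rw [h1.isHermitian.eq] at hX'
  have h := (hX.add hX').smul (inv_pos.mpr hc).le
  convert h using 1
  rw [eq_inv_smul_iff₀ hc.ne']
  simp only [mul_sub, sub_mul, smul_mul_assoc, mul_smul_comm, one_mul, mul_one, smul_sub]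
  abel

theorem sigmaMax_le_of_loewner {d : ℕ} {c : ℝ} (hc : 0 < c)
    {X : Matrix (Fin d) (Fin d) ℝ} (h0 : X.PosSemidef) (h1 : Loewner X (c • 1)) :
    sigmaMax X ≤ c := by
  refine ContinuousLinearMap.opNorm_le_bound _ hc.le fun v => ?_
  set T := Matrix.toEuclideanCLM (𝕜 := ℝ) X with hT
  have hsymm : star T = T := by
    rw [hT, ← map_star, star_eq_conjTranspose, h0.isHermitian.eq]
  have hpos := (h0.smul_sub_mul_self hc h1).dotProduct_mulVec_nonneg (WithLp.ofLp v)
  have key : ‖T v‖ * ‖T v‖ ≤ c * inner ℝ (T v) v := by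
    have h2 : inner ℝ (T (T v)) v = ‖T v‖ * ‖T v‖ := by
      rw [← ContinuousLinearMap.adjoint_inner_right, ← ContinuousLinearMap.star_eq_adjoint,
        hsymm, real_inner_self_eq_norm_mul_norm]
    rw [← h2, hT]
    simp only [sub_mulVec, smul_mulVec, dotProduct_sub, dotProduct_smul, star_trivial,
      ← mulVec_mulVec, smul_eq_mul, sub_nonneg] at hpos
    simpa [EuclideanSpace.inner_eq_star_dotProduct] using hpos
  have hcs := real_inner_le_norm (T v) v
  rcases (norm_nonneg (T v)).eq_or_lt with h | h
  · rw [← h]; positivity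
  · refine le_of_mul_le_mul_left ?_ h
    nlinarith

/-- Lemma 7: if `0 ⪯ X ⪯ (1/ε) I`, `0 ⪯ Y ⪯ (1/ε) I` and `Θ` is
symmetric, then `σ̄(XΘX - YΘY) ≤ (3 σ̄(Θ)/ε) σ̄(X - Y)`. -/
theorem sigmaMax_conj_sub_le
    (d : ℕ) (ε : ℝ) (hε : 0 < ε) (X Y Θ : Matrix (Fin d) (Fin d) ℝ)
    (hΘ : Θ.IsSymm)
    (hX0 : X.PosSemidef) (hX1 : Loewner X ((1 / ε) • (1 : Matrix (Fin d) (Fin d) ℝ)))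
    (hY0 : Y.PosSemidef) (hY1 : Loewner Y ((1 / ε) • (1 : Matrix (Fin d) (Fin d) ℝ))) :
    sigmaMax (X * Θ * X - Y * Θ * Y) ≤ (3 * sigmaMax Θ / ε) * sigmaMax (X - Y) := by
  have hε' : 0 < 1 / ε := one_div_pos.mpr hε
  have hX := sigmaMax_le_of_loewner hε' hX0 hX1
  have hY := sigmaMax_le_of_loewner hε' hY0 hY1
  have hsplit : X * Θ * X - Y * Θ * Y = X * Θ * (X - Y) + (X - Y) * Θ * Y := by noncomm_ring
  unfold sigmaMax at *
  rw [hsplit, map_add, map_mul, map_mul, map_mul, map_mul]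
  set D := Matrix.toEuclideanCLM (𝕜 := ℝ) (X - Y)
  set T := Matrix.toEuclideanCLM (𝕜 := ℝ) Θ
  set A := Matrix.toEuclideanCLM (𝕜 := ℝ) X
  set B := Matrix.toEuclideanCLM (𝕜 := ℝ) Y
  calc ‖A * T * D + D * T * B‖
      ≤ ‖A‖ * ‖T‖ * ‖D‖ + ‖D‖ * ‖T‖ * ‖B‖ :=
        norm_add_le_of_le (norm_mul₃_le) (norm_mul₃_le)
    _ ≤ 1 / ε * ‖T‖ * ‖D‖ + ‖D‖ * ‖T‖ * (1 / ε) := by gcongr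
    _ = 2 * ‖T‖ / ε * ‖D‖ := by ring
    _ ≤ 3 * ‖T‖ / ε * ‖D‖ := by gcongr; norm_num
end
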